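/- Bypass of a closed edge: let x, y ∈ C_∞, let γ ∈ G_*(x,y), and let e be a closed edge of γ such that not both x and y lie in Λ_{3R_e}(e). Then there exists a path η_e ∈ G_*(x,y) such that: (i) no closed edge of η_e lies in Λ_{R_e}(e), and η_e \ γ is an open path contained in Λ_{4R_e}(e); (ii) |η_e \ γ| ≤ 2 C_* R_e. -/

import Mathlib

open MeasureTheory
open scoped ENNReal NNReal

attribute [local instance] Classical.propDecidable

noncomputable section

namespace Perco

/-- Vertices of the lattice `ℤ^d`. -/
abbrev ZVec (d : ℕ) := Fin d → ℤ

/-- The `ℓ¹` norm of a lattice point (as a natural number). -/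
def norm1 (d : ℕ) (x : ZVec d) : ℕ := ∑ i, (x i).natAbs

/-- The `ℓ∞` norm of a lattice point (as a natural number). -/
def normInf (d : ℕ) (x : ZVec d) : ℕ := Finset.univ.sup fun i => (x i).natAbs

/-- Nearest-neighbour edges of `ℤ^d`, each written `(x_e, y_e)` with `‖x_e‖₁ < ‖y_e‖₁`. -/
def EdgeD (d : ℕ) := {e : ZVec d × ZVec d // norm1 d (e.1 - e.2) = 1 ∧ norm1 d e.1 < norm1 d e.2}

/-- A percolation configuration: each edge is open (`true`) or closed (`false`). -/
abbrev Config (d : ℕ) := EdgeD d → Bool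

/-- Adjacency in `ℤ^d`. -/
def Adj (d : ℕ) (x y : ZVec d) : Prop := norm1 d (x - y) = 1

/-- A (self-avoiding, nearest-neighbour) path, recorded as its list of vertices. -/
def IsPath (d : ℕ) (γ : List (ZVec d)) : Prop :=
  γ ≠ [] ∧ γ.Nodup ∧ γ.Chain' (Adj d)

/-- The (unordered) edge `{x,y}` is open in the configuration `ω`. -/
def EdgeOpen (d : ℕ) (ω : Config d) (x y : ZVec d) : Prop :=
  ∃ e : EdgeD d, (e.val = (x, y) ∨ e.val = (y, x)) ∧ ω e = true

/-- All edges of the path are open. -/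
def IsOpenPath (d : ℕ) (ω : Config d) (γ : List (ZVec d)) : Prop :=
  γ.Chain' (EdgeOpen d ω)

/-- The (unordered) edge `{x,y}` is an edge of the path `γ`. -/
def edgeMemPath (d : ℕ) (x y : ZVec d) (γ : List (ZVec d)) : Prop :=
  (x, y) ∈ γ.zip γ.tail ∨ (y, x) ∈ γ.zip γ.tail

/-- Truncated FPP weight of the edge `{x,y}`: `1` if open, `log² n` if closed. -/
def pairWeight (d n : ℕ) (ω : Config d) (x y : ZVec d) : ℝ :=
  if EdgeOpen d ω x y then 1 else (Real.log n) ^ 2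

/-- Total truncated weight of a path. -/
def pathCost (d n : ℕ) (ω : Config d) : List (ZVec d) → ℝ
  | [] => 0
  | [_] => 0
  | x :: y :: rest => pairWeight d n ω x y + pathCost d n ω (y :: rest)

/-- Truncated first-passage time between `x` and `y`. -/
def passageTime (d n : ℕ) (ω : Config d) (x y : ZVec d) : ℝ :=
  sInf {c : ℝ | ∃ γ : List (ZVec d), IsPath d γ ∧ γ.head? = some x ∧
    γ.getLast? = some y ∧ pathCost d n ω γ = c}

/-- Chemical distance between `x` and `y` using only open paths inside `U`. -/
def chemDistIn (d : ℕ) (ω : Config d) (U : Set (ZVec d)) (x y : ZVec d) : ℕ∞ :=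
  sInf {k : ℕ∞ | ∃ γ : List (ZVec d), IsPath d γ ∧ IsOpenPath d ω γ ∧ (∀ v ∈ γ, v ∈ U) ∧
    γ.head? = some x ∧ γ.getLast? = some y ∧ ((γ.length - 1 : ℕ) : ℕ∞) = k}

/-- Chemical distance in the whole lattice. -/
def chemDist (d : ℕ) (ω : Config d) (x y : ZVec d) : ℕ∞ := chemDistIn d ω Set.univ x y

/-- `x` belongs to an infinite open cluster. -/
def InInfCluster (d : ℕ) (ω : Config d) (x : ZVec d) : Prop :=
  {y | chemDist d ω x y ≠ ⊤}.Infinite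

/-- `x*`: a point of the infinite cluster at minimal `ℓ∞`-distance from `x`
(deterministic tie-breaking via choice); `x` itself if there is no infinite cluster. -/
def starPt (d : ℕ) (ω : Config d) (x : ZVec d) : ZVec d :=
  if h : ∃ y, InInfCluster d ω y ∧ ∀ z, InInfCluster d ω z →
      normInf d (y - x) ≤ normInf d (z - x)
  then h.choose else x

/-- `μ` is the Bernoulli(p) bond-percolation product measure on configurations. -/
def IsBernoulli (d : ℕ) (p : ℝ) (μ : Measure (Config d)) : Prop :=
  IsProbabilityMeasure μ ∧
  ∀ (s : Finset (EdgeD d)) (f : EdgeD d → Bool),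
    μ {ω | ∀ e ∈ s, ω e = f e} = ∏ e ∈ s, ENNReal.ofReal (if f e then p else 1 - p)

/-- The critical parameter of Bernoulli bond percolation on `ℤ^d`. -/
def pc (d : ℕ) : ℝ :=
  sSup {p : ℝ | 0 ≤ p ∧ p ≤ 1 ∧ ∀ μ : Measure (Config d), IsBernoulli d p μ →
    μ {ω | ∃ x, InInfCluster d ω x} = 0}

/-- The point `n·e₁`. -/
def ptE1 (d n : ℕ) : ZVec d := fun i => if (i : ℕ) = 0 then (n : ℤ) else 0

/-- `D*_n = D(0*, (n e₁)*)`, as a real number. -/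
def DstarR (d n : ℕ) (ω : Config d) : ℝ :=
  ((chemDist d ω (starPt d ω 0) (starPt d ω (ptE1 d n))).toNat : ℝ)

/-- `T_n = T(0, n e₁)`, the truncated passage time. -/
def TnR (d n : ℕ) (ω : Config d) : ℝ := passageTime d n ω 0 (ptE1 d n)

/-- The box `Λ_t(z)` with integer radius. -/
def boxZ (d : ℕ) (t : ℕ) (z : ZVec d) : Set (ZVec d) := {y | normInf d (y - z) ≤ t}

/-- The box `Λ_t(z)` with real radius. -/
def boxR (d : ℕ) (t : ℝ) (z : ZVec d) : Set (ZVec d) := {y | (normInf d (y - z) : ℝ) ≤ t}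

/-- The annulus `A_N(e) = Λ_{3N}(e) \ Λ_N(e)`. -/
def annulus (d : ℕ) (N : ℕ) (e : EdgeD d) : Set (ZVec d) :=
  {y | normInf d (y - e.val.1) ≤ 3 * N ∧ N < normInf d (y - e.val.1)}

/-- `π` is a geodesic of the truncated passage time between its endpoints, inside `A`. -/
def IsGeodesicIn (d n : ℕ) (ω : Config d) (A : Set (ZVec d)) (π : List (ZVec d)) : Prop :=
  IsPath d π ∧ (∀ v ∈ π, v ∈ A) ∧
  ∀ π' : List (ZVec d), IsPath d π' → (∀ v ∈ π', v ∈ A) →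
    π'.head? = π.head? → π'.getLast? = π.getLast? →
    pathCost d n ω π ≤ pathCost d n ω π'

/-- `γ ∈ 𝔾_*(A)`: a path in `A` obtained from some geodesic in `A` by replacing
segments by open paths (all edges of `γ` not on the geodesic are open). -/
def GstarIn (d n : ℕ) (ω : Config d) (A : Set (ZVec d)) (γ : List (ZVec d)) : Prop :=
  IsPath d γ ∧ (∀ v ∈ γ, v ∈ A) ∧
  ∃ π : List (ZVec d), IsGeodesicIn d n ω A π ∧
    ∀ x y, edgeMemPath d x y γ → ¬ edgeMemPath d x y π → EdgeOpen d ω x y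

/-- `γ` is a crossing path of the annulus `A_N(e)`. -/
def IsCrossing (d : ℕ) (N : ℕ) (e : EdgeD d) (γ : List (ZVec d)) : Prop :=
  IsPath d γ ∧ (∀ v ∈ γ, v ∈ annulus d N e) ∧
  (∃ v ∈ γ, normInf d (v - e.val.1) = N + 1) ∧ (∃ v ∈ γ, normInf d (v - e.val.1) = 3 * N)

/-- The event `𝒱¹_N(e)`: any two modified geodesics crossing `A_N(e)` are linked by an
open path inside `A_N(e)` of length at most `C_* N`. -/
def V1 (d : ℕ) (Cstar : ℝ) (n : ℕ) (e : EdgeD d) (N : ℕ) (ω : Config d) : Prop :=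
  ∀ γ1 γ2 : List (ZVec d),
    GstarIn d n ω (boxR d (Cstar * N) e.val.1) γ1 → IsCrossing d N e γ1 →
    GstarIn d n ω (boxR d (Cstar * N) e.val.1) γ2 → IsCrossing d N e γ2 →
    ∃ π : List (ZVec d), IsPath d π ∧ IsOpenPath d ω π ∧ (∀ v ∈ π, v ∈ annulus d N e) ∧
      (∃ u, π.head? = some u ∧ u ∈ γ1) ∧ (∃ v, π.getLast? = some v ∧ v ∈ γ2) ∧
      ((π.length : ℝ) - 1 ≤ Cstar * N)

/-- The event `𝒱²_N(e)`: points of `Λ_{3N}(e)` openly connected inside `Λ_{3N}(e)` are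
connected inside `Λ_{4N}(e)` by an open path of length at most `C_* N`. -/
def V2 (d : ℕ) (Cstar : ℝ) (e : EdgeD d) (N : ℕ) (ω : Config d) : Prop :=
  ∀ x y : ZVec d, x ∈ boxZ d (3 * N) e.val.1 → y ∈ boxZ d (3 * N) e.val.1 →
    (∃ γ, IsPath d γ ∧ IsOpenPath d ω γ ∧ (∀ v ∈ γ, v ∈ boxZ d (3 * N) e.val.1) ∧
      γ.head? = some x ∧ γ.getLast? = some y) →
    ∃ γ, IsPath d γ ∧ IsOpenPath d ω γ ∧ (∀ v ∈ γ, v ∈ boxZ d (4 * N) e.val.1) ∧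
      γ.head? = some x ∧ γ.getLast? = some y ∧ ((γ.length : ℝ) - 1 ≤ Cstar * N)

/-- The effective radius `R_e` as a natural number (`0` when undefined). -/
def ReffN (d : ℕ) (Cstar : ℝ) (n : ℕ) (e : EdgeD d) (ω : Config d) : ℕ :=
  sInf {N : ℕ | 1 ≤ N ∧ V1 d Cstar n e N ω ∧ V2 d Cstar e N ω}

/-- The effective radius `R_e`, valued in `ℝ≥0∞` (`∞` when undefined). -/
def ReffENN (d : ℕ) (Cstar : ℝ) (n : ℕ) (e : EdgeD d) (ω : Config d) : ℝ≥0∞ :=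
  sInf {r : ℝ≥0∞ | ∃ N : ℕ, r = N ∧ 1 ≤ N ∧ V1 d Cstar n e N ω ∧ V2 d Cstar e N ω}

/-- The truncated effective radius `R̂_e = min (C_* R_e) (log² n)`. -/
def RhatR (d : ℕ) (Cstar : ℝ) (n : ℕ) (e : EdgeD d) (ω : Config d) : ℝ :=
  (min (ENNReal.ofReal Cstar * ReffENN d Cstar n e ω)
    (ENNReal.ofReal ((Real.log n) ^ 2))).toReal

/-- `diam(γ) ≥ r`. -/
def DiamGE (d : ℕ) (γ : List (ZVec d)) (r : ℝ) : Prop :=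
  ∃ i : Fin d, ∃ x ∈ γ, ∃ y ∈ γ, r ≤ |((x i : ℤ) : ℝ) - ((y i : ℤ) : ℝ)|

/-- The boundary `∂Λ_t` (real radius `t`). -/
def bdryR (d : ℕ) (t : ℝ) : Set (ZVec d) :=
  {x | (normInf d x : ℝ) ≤ t ∧ t - 1 < (normInf d x : ℝ)}

/-- The slab `S(ℓ,t) = {x ∈ Λ_t : 0 ≤ x₁ ≤ ℓ}`. -/
def slab (d : ℕ) (l t : ℝ) : Set (ZVec d) :=
  {x | (normInf d x : ℝ) ≤ t ∧ ∀ i : Fin d, (i : ℕ) = 0 → 0 ≤ x i ∧ ((x i : ℤ) : ℝ) ≤ l}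

/-- The open cluster of the vertex `v`. -/
def openClusterOf (d : ℕ) (ω : Config d) (v : ZVec d) : Set (ZVec d) :=
  {y | chemDist d ω v y ≠ ⊤}

/-- The set `C` crosses the box `Λ_t(z)`: in each direction an open path of `C ∩ Λ_t(z)`
connects the two opposite faces. -/
def CrossesBox (d : ℕ) (ω : Config d) (C : Set (ZVec d)) (t : ℕ) (z : ZVec d) : Prop :=
  ∀ i : Fin d, ∃ γ, IsPath d γ ∧ IsOpenPath d ω γ ∧ (∀ u ∈ γ, u ∈ C ∧ u ∈ boxZ d t z) ∧
    (∃ u ∈ γ, u i = z i - t) ∧ (∃ u ∈ γ, u i = z i + t)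

/-- The event `𝓔_N`: some crossing open cluster of `Λ_{2N}` is avoided by a modified
geodesic `π ⊆ Λ_N` of diameter at least `N/2` belonging to `𝔾_*(Λ_{tN})`. -/
def ENevent (d n : ℕ) (t : ℝ) (N : ℕ) : Set (Config d) :=
  {ω | ∃ v0 : ZVec d, CrossesBox d ω (openClusterOf d ω v0) (2 * N) 0 ∧
    ∃ π : List (ZVec d), IsPath d π ∧ (∀ u ∈ π, u ∈ boxZ d N 0) ∧
      GstarIn d n ω (boxR d (t * N) 0) π ∧ DiamGE d π ((N : ℝ) / 2) ∧
      ∀ u ∈ π, u ∉ openClusterOf d ω v0}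

/-- `ρ` is a Garet–Marchand moderate-deviation constant for the chemical distance. -/
def GMprop (d : ℕ) (μ : Measure (Config d)) (ρ : ℝ) : Prop :=
  1 ≤ ρ ∧ ∃ c : ℝ, 0 < c ∧ ∀ x : ZVec d, ∀ t : ℝ, ρ * (normInf d x : ℝ) ≤ t →
    μ {ω | chemDist d ω 0 x ≠ ⊤ ∧ t ≤ ((chemDist d ω 0 x).toNat : ℝ)}
      ≤ ENNReal.ofReal (c⁻¹ * Real.exp (-c * t)) ∧
    μ {ω | t ≤ ((chemDist d ω (starPt d ω 0) (starPt d ω x)).toNat : ℝ) ∨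
        chemDist d ω (starPt d ω 0) (starPt d ω x) = ⊤}
      ≤ ENNReal.ofReal (c⁻¹ * Real.exp (-c * t))

/-- `cs` is a constant for which the crossing-cluster avoidance lemma holds. -/
def CrossProp (d : ℕ) (μ : Measure (Config d)) (cs : ℝ) : Prop :=
  0 < cs ∧ cs < 1 ∧ ∀ n : ℕ, 2 ≤ n → ∀ t : ℝ, 1 / cs ≤ t → ∀ N : ℕ, 1 ≤ N →
    (N : ℝ) ≤ Real.exp (cs * (Real.log n) ^ 2) →
    μ (ENevent d n t N) ≤ ENNReal.ofReal (cs⁻¹ * Real.exp (-cs * N))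

/-- `N_ρ = ⌊N / (16 ρ²)⌋`. -/
def Nrho (ρ : ℝ) (N : ℕ) : ℕ := Nat.floor ((N : ℝ) / (16 * ρ ^ 2))

/-- The cube of side-length `m` with lower corner `z`. -/
def cube (d : ℕ) (m : ℕ) (z : ZVec d) : Set (ZVec d) :=
  {y | ∀ i, z i ≤ y i ∧ y i ≤ z i + m}

/-- The open cluster of `v` inside `U`. -/
def clusterIn (d : ℕ) (ω : Config d) (U : Set (ZVec d)) (v : ZVec d) : Set (ZVec d) :=
  {y | chemDistIn d ω U v y ≠ ⊤}

/-- `k ≤ r` for `k : ℕ∞` and `r : ℝ` (in particular `k` is finite). -/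
def chemLE (k : ℕ∞) (r : ℝ) : Prop := ∃ m : ℕ, k = (m : ℕ∞) ∧ (m : ℝ) ≤ r

/-- The box `Λ_{3N}(e)` is good (Definition 2.2 of the paper). -/
def GoodBox (d n : ℕ) (ρ Cstar : ℝ) (e : EdgeD d) (N : ℕ) (ω : Config d) : Prop :=
  (∃ v0 ∈ boxZ d (3 * N) e.val.1,
    (∀ z : ZVec d, cube d (Nrho ρ N) z ⊆ boxZ d (3 * N) e.val.1 →
      ∀ i : Fin d, ∃ γ, IsPath d γ ∧ IsOpenPath d ω γ ∧
        (∀ u ∈ γ, u ∈ clusterIn d ω (boxZ d (3 * N) e.val.1) v0 ∧ u ∈ cube d (Nrho ρ N) z) ∧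
        (∃ u ∈ γ, u i = z i) ∧ (∃ u ∈ γ, u i = z i + (Nrho ρ N : ℤ))) ∧
    (∀ π, IsPath d π → (∀ u ∈ π, u ∈ boxZ d (3 * N) e.val.1) →
      GstarIn d n ω (boxR d (Cstar * N) e.val.1) π → DiamGE d π ((Nrho ρ N : ℝ)) →
      ∃ u ∈ π, u ∈ clusterIn d ω (boxZ d (3 * N) e.val.1) v0)) ∧
  (∀ x y : ZVec d, x ∈ boxZ d (3 * N) e.val.1 → y ∈ boxZ d (3 * N) e.val.1 →
    normInf d (x - y) ≤ 2 * Nrho ρ N → chemDist d ω x y ≠ ⊤ →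
    chemDistIn d ω (boxZ d (4 * N) e.val.1) x y = chemDist d ω x y ∧
    chemLE (chemDist d ω x y) (4 * ρ * (Nrho ρ N : ℝ))) ∧
  (∀ x y : ZVec d, x ∈ annulus d N e → y ∈ annulus d N e →
    (∀ b : ZVec d, (normInf d (b - e.val.1) = N ∨ normInf d (b - e.val.1) = 3 * N) →
      (N : ℝ) / 2 ≤ (normInf d (x - b) : ℝ) ∧ (N : ℝ) / 2 ≤ (normInf d (y - b) : ℝ)) →
    normInf d (x - y) ≤ 2 * Nrho ρ N → chemDist d ω x y ≠ ⊤ →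
    chemDistIn d ω (annulus d N e) x y = chemDist d ω x y ∧
    chemLE (chemDist d ω x y) (4 * ρ * (Nrho ρ N : ℝ)))

/-- Evaluate an edge-indexed function at the (unordered) pair `{x,y}`, `0` if not an edge. -/
def edgeFnVal (d : ℕ) (g : EdgeD d → ℝ) (x y : ZVec d) : ℝ :=
  if h : ∃ e : EdgeD d, e.val = (x, y) ∨ e.val = (y, x) then g h.choose else 0

/-- The sum of `g` over the edges of the path `γ`. -/
def pathSum (d : ℕ) (g : EdgeD d → ℝ) (γ : List (ZVec d)) : ℝ :=
  ((γ.zip γ.tail).map fun pr => edgeFnVal d g pr.1 pr.2).sum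

/-- Number of edges of `η` that are not edges of `γ`, i.e. `|η \ γ|`. -/
def diffEdgeCount (d : ℕ) (η γ : List (ZVec d)) : ℕ :=
  ((η.zip η.tail).filter fun pr => decide (¬ edgeMemPath d pr.1 pr.2 γ)).length

/-- Maximal total weight of a lattice animal (path) in `Ξ_L`. -/
def animalMax (d : ℕ) (L : ℕ) (g : EdgeD d → ℝ) : ℝ :=
  sSup {r : ℝ | ∃ γ : List (ZVec d), IsPath d γ ∧ (∀ v ∈ γ, v ∈ boxZ d L 0) ∧
    γ.length ≤ L + 1 ∧ r = pathSum d g γ}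

/-- `m = ⌊n^{1/4}⌋`. -/
def mOf (n : ℕ) : ℕ := Nat.floor ((n : ℝ) ^ ((1 : ℝ) / 4))

/-- The box `Λ_m` as a finite set. -/
def boxFinset (d m : ℕ) : Finset (ZVec d) := Finset.Icc (fun _ => -(m : ℤ)) (fun _ => (m : ℤ))

/-- The spatially averaged passage time `F_m`. -/
def Fm (d n : ℕ) (ω : Config d) : ℝ :=
  (∑ z ∈ boxFinset d (mOf n), passageTime d n ω z (z + ptE1 d n)) / (boxFinset d (mOf n)).card

/-- The σ-algebra generated by the states of the first `i` edges. -/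
def edgeFiltration (d : ℕ) (ε : ℕ ≃ EdgeD d) (i : ℕ) : MeasurableSpace (Config d) :=
  MeasurableSpace.comap (fun ω (j : Fin i) => ω (ε j)) MeasurableSpace.pi

/-- The martingale increment `Δ_i = E[e^{λ F_m} | 𝓕_i] − E[e^{λ F_m} | 𝓕_{i−1}]`. -/
def mgDelta (d n : ℕ) (ε : ℕ ≃ EdgeD d) (lam : ℝ) (μ : Measure (Config d)) (i : ℕ) :
    Config d → ℝ :=
  fun ω => (μ[fun ω' => Real.exp (lam * Fm d n ω') | edgeFiltration d ε i]) ω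
    - (μ[fun ω' => Real.exp (lam * Fm d n ω') | edgeFiltration d ε (i - 1)]) ω

/-- The entropy `Ent[X] = E[X log (X / E[X])]`. -/
def entOf {α : Type*} [MeasurableSpace α] (μ : Measure α) (X : α → ℝ) : ℝ :=
  ∫ ω, X ω * Real.log (X ω / ∫ ω', X ω' ∂μ) ∂μ

end Perco
namespace Perco

/-- Consecutive pairs of entries of a list. -/
def pairs {α : Type*} (L : List α) : List (α × α) := L.zip L.tail

/-- The list `L` starts at `u` and ends at `v`. -/
def IsWalk {α : Type*} (u v : α) (L : List α) : Prop := L.head? = some u ∧ L.getLast? = some v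

section Lists
variable {α : Type*}

@[simp] lemma pairs_nil : pairs ([] : List α) = [] := rfl
@[simp] lemma pairs_singleton (a : α) : pairs [a] = [] := rfl
@[simp] lemma pairs_cons_cons (a b : α) (L : List α) :
    pairs (a :: b :: L) = (a, b) :: pairs (b :: L) := rfl

lemma pairs_append_cons (A B : List α) (v : α) :
    pairs (A ++ v :: B) = pairs (A ++ [v]) ++ pairs (v :: B) := by
  induction A with
  | nil => simp
  | cons a A ih => cases A <;> simp_all

lemma length_pairs (L : List α) : (pairs L).length = L.length - 1 := by
  simp [pairs]

lemma isChain_iff_pairs (R : α → α → Prop) (L : List α) :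
    L.IsChain R ↔ ∀ p ∈ pairs L, R p.1 p.2 := by
  induction L with
  | nil => simp
  | cons a L ih => cases L <;> simp_all

lemma mem_of_mem_pairs {L : List α} {p : α × α} (h : p ∈ pairs L) : p.1 ∈ L ∧ p.2 ∈ L := by
  obtain ⟨a, b⟩ := p
  have := List.of_mem_zip h
  exact ⟨this.1, List.mem_of_mem_tail this.2⟩

lemma mem_pairs_iff_getElem {L : List α} {a b : α} :
    (a, b) ∈ pairs L ↔ ∃ i, ∃ h : i + 1 < L.length, L[i] = a ∧ L[i + 1] = b := by
  simp only [pairs, List.mem_iff_getElem, List.getElem_zip, List.length_zip, List.length_tail,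
    List.getElem_tail, Prod.mk.injEq]
  constructor
  · rintro ⟨i, h, h1, h2⟩
    exact ⟨i, by omega, h1, h2⟩
  · rintro ⟨i, h, h1, h2⟩
    exact ⟨i, by omega, h1, h2⟩

lemma pairs_reverse (L : List α) : pairs L.reverse = ((pairs L).map Prod.swap).reverse := by
  induction L with
  | nil => rfl
  | cons a L ih =>
    cases L with
    | nil => rfl
    | cons b L =>
      have : (a :: b :: L).reverse = L.reverse ++ b :: [a] := by simp
      rw [this, pairs_append_cons]
      simp only [List.reverse_cons] at ih
      simp [ih]

lemma mem_pairs_reverse {L : List α} {p : α × α} : p ∈ pairs L.reverse ↔ p.swap ∈ pairs L := by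
  simp only [pairs_reverse, List.mem_reverse, List.mem_map]
  constructor
  · rintro ⟨q, hq, rfl⟩; simpa using hq
  · intro h; exact ⟨_, h, by simp⟩

lemma IsWalk.reverse {u v : α} {L : List α} (h : IsWalk u v L) : IsWalk v u L.reverse := by
  simpa [IsWalk, and_comm] using h

lemma IsWalk.left_mem {u v : α} {L : List α} (h : IsWalk u v L) : u ∈ L :=
  List.mem_of_mem_head? h.1

lemma IsWalk.right_mem {u v : α} {L : List α} (h : IsWalk u v L) : v ∈ L :=
  List.mem_of_getLast? h.2

lemma isWalk_singleton (u : α) : IsWalk u u [u] := ⟨rfl, rfl⟩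

lemma IsWalk.glue {u v w : α} {A B : List α} (hA : IsWalk u v A) (hB : IsWalk v w B) :
    ∃ C, IsWalk u w C ∧ pairs C = pairs A ++ pairs B ∧ ∀ z ∈ C, z ∈ A ∨ z ∈ B := by
  obtain ⟨A', rfl⟩ := List.getLast?_eq_some_iff.1 hA.2
  obtain ⟨B', rfl⟩ := List.head?_eq_some_iff.1 hB.1
  refine ⟨A' ++ v :: B', ⟨?_, ?_⟩, pairs_append_cons _ _ _, ?_⟩
  · have := hA.1
    cases A' <;> simpa using this
  · have := hB.2
    simpa [List.getLast?_append] using this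
  · intro z hz
    simp only [List.mem_append, List.mem_cons] at hz ⊢
    tauto

/-- Loop erasure. -/
lemma IsWalk.exists_nodup {u v : α} {A : List α} (hA : IsWalk u v A) :
    ∃ C, IsWalk u v C ∧ C.Nodup ∧ (pairs C).Sublist (pairs A) ∧ C ⊆ A := by
  induction A generalizing u with
  | nil => simp [IsWalk] at hA
  | cons a A ih =>
    obtain rfl : a = u := by simpa using hA.1
    cases A with
    | nil => exact ⟨[a], hA, by simp, by simp, by simp⟩
    | cons b A =>
      have hb : IsWalk b v (b :: A) := ⟨rfl, by simpa [List.getLast?_cons_cons] using hA.2⟩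
      obtain ⟨C, hC, hnd, hsub, hss⟩ := ih hb
      by_cases ha : a ∈ C
      · obtain ⟨S, T, rfl⟩ := List.append_of_mem ha
        refine ⟨a :: T, ⟨rfl, ?_⟩, ?_, ?_, ?_⟩
        · have := hC.2
          simpa [List.getLast?_append] using this
        · exact (List.nodup_append.1 hnd).2.1
        · rw [pairs_append_cons] at hsub
          rw [pairs_cons_cons]
          exact ((List.sublist_append_right _ _).trans hsub).trans (List.sublist_cons_self _ _)
        · intro z hz
          exact List.mem_cons_of_mem _ (hss (List.mem_append_right _ hz))
      · obtain ⟨C', rfl⟩ := List.head?_eq_some_iff.1 hC.1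
        refine ⟨a :: b :: C', ⟨rfl, ?_⟩, ?_, ?_, ?_⟩
        · simpa [List.getLast?_cons_cons] using hC.2
        · exact List.nodup_cons.2 ⟨ha, hnd⟩
        · simpa using hsub
        · exact List.cons_subset_cons _ hss

lemma IsWalk.split {u w v : α} {A : List α} (hA : IsWalk u w A) (hv : v ∈ A) :
    ∃ B C, IsWalk u v B ∧ IsWalk v w C ∧ pairs A = pairs B ++ pairs C ∧ B ⊆ A ∧ C ⊆ A := by
  obtain ⟨S, T, rfl⟩ := List.append_of_mem hv
  refine ⟨S ++ [v], v :: T, ⟨?_, by simp⟩, ⟨rfl, ?_⟩, pairs_append_cons _ _ _, ?_, ?_⟩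
  · have := hA.1
    cases S <;> simpa using this
  · have := hA.2
    simpa [List.getLast?_append] using this
  · intro z; simp; tauto
  · intro z; simp; tauto

lemma exists_first {P : α → Prop} {L : List α} (h : ∃ z ∈ L, P z) :
    ∃ B z C, L = B ++ z :: C ∧ P z ∧ ∀ t ∈ B, ¬ P t := by
  induction L with
  | nil => simp at h
  | cons a L ih =>
    by_cases ha : P a
    · exact ⟨[], a, L, rfl, ha, by simp⟩
    · obtain ⟨B, z, C, rfl, hz, hB⟩ := ih (by
        obtain ⟨z, hz, hP⟩ := h
        rcases List.mem_cons.1 hz with rfl | hz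
        · exact absurd hP ha
        · exact ⟨z, hz, hP⟩)
      exact ⟨a :: B, z, C, rfl, hz, by simpa [ha] using hB⟩

lemma exists_last {P : α → Prop} {L : List α} (h : ∃ z ∈ L, P z) :
    ∃ B z C, L = B ++ z :: C ∧ P z ∧ ∀ t ∈ C, ¬ P t := by
  obtain ⟨B, z, C, hL, hz, hB⟩ := exists_first (L := L.reverse) (P := P) (by simpa using h)
  refine ⟨C.reverse, z, B.reverse, ?_, hz, by simpa using hB⟩
  have := congrArg List.reverse hL
  simpa using this

lemma pairs_append_eq_getElem_split (L : List α) {i : ℕ} (h : i < L.length) :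
    pairs L = pairs (L.take (i + 1)) ++ pairs (L.drop i) := by
  have h1 : L.take (i + 1) = L.take i ++ [L[i]] := by simp
  have h2 : L.drop i = L[i] :: L.drop (i + 1) := List.drop_eq_getElem_cons h
  rw [h1, h2, ← pairs_append_cons, ← h2, List.take_append_drop]

/-- The entries of `L` with indices in `[l, r]`. -/
def segment (L : List α) (l r : ℕ) : List α := (L.take (r + 1)).drop l

lemma exists_isWalk_segment {L : List α} {a b : α} (hL : IsWalk a b L) {l r : ℕ} (hlr : l ≤ r)
    (hr : r < L.length) :
    IsWalk L[l] L[r] (segment L l r) ∧ ∃ P Q, IsWalk a L[l] P ∧ IsWalk L[r] b Q ∧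
      pairs L = pairs P ++ (pairs (segment L l r) ++ pairs Q) := by
  have hlen : (segment L l r).length = r + 1 - l := by
    simp [segment]; omega
  refine ⟨⟨?_, ?_⟩, L.take (l + 1), L.drop r, ⟨?_, ?_⟩, ⟨?_, ?_⟩, ?_⟩
  · rw [List.head?_eq_getElem?]
    simp [segment]; grind
  · rw [List.getLast?_eq_getElem?, hlen]
    simp [segment]; grind
  · rw [← hL.1, List.head?_take]; simp
  · rw [List.getLast?_eq_getElem?]
    simp; grind
  · rw [List.head?_eq_getElem?]
    simp
  · rw [← hL.2, List.getLast?_drop]; grind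
  · rw [pairs_append_eq_getElem_split L hr,
      pairs_append_eq_getElem_split (L.take (r + 1)) (i := l) (by simp; omega),
      List.append_assoc, List.take_take]
    simp [segment, hlr]

lemma length_segment {L : List α} {l r : ℕ} (hr : r < L.length) :
    (segment L l r).length = r + 1 - l := by
  simp [segment]; omega

lemma mem_segment {L : List α} {l r : ℕ} (hr : r < L.length) {z : α} (hz : z ∈ segment L l r) :
    ∃ m, ∃ h : m < L.length, l ≤ m ∧ m ≤ r ∧ L[m] = z := by
  obtain ⟨i, hi, rfl⟩ := List.mem_iff_getElem.1 hz
  have := length_segment (l := l) hr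
  refine ⟨l + i, by omega, by omega, by omega, ?_⟩
  simp [segment]

lemma mem_pairs_segment {L : List α} {l r m : ℕ} (hr : r < L.length) (hl : l ≤ m) (hm : m < r) :
    (L[m], L[m + 1]) ∈ pairs (segment L l r) := by
  have := length_segment (l := l) hr
  refine mem_pairs_iff_getElem.2 ⟨m - l, by omega, ?_, ?_⟩ <;> simp [segment] <;> grind

lemma segment_sublist (L : List α) (l r : ℕ) : (segment L l r).Sublist L :=
  (List.drop_sublist _ _).trans (List.take_sublist _ _)

end Lists
section Lattice
variable {d n : ℕ} {ω : Config d}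

lemma EdgeOpen.symm {a b : ZVec d} (h : EdgeOpen d ω a b) : EdgeOpen d ω b a := by
  obtain ⟨e, he, ho⟩ := h
  exact ⟨e, he.symm, ho⟩

lemma edgeMemPath.symm {a b : ZVec d} {L : List (ZVec d)} (h : edgeMemPath d a b L) :
    edgeMemPath d b a L := Or.symm h

lemma norm1_sub_comm (a b : ZVec d) : norm1 d (a - b) = norm1 d (b - a) := by
  simp only [norm1, Pi.sub_apply]
  exact Finset.sum_congr rfl fun i _ => by omega

lemma Adj.symm {a b : ZVec d} (h : Adj d a b) : Adj d b a := by
  rw [Adj, norm1_sub_comm]; exact h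

lemma EdgeOpen.adj {a b : ZVec d} (h : EdgeOpen d ω a b) : Adj d a b := by
  obtain ⟨e, he | he, -⟩ := h
  · have := e.2.1; rw [he] at this; exact this
  · have := e.2.1; rw [he] at this; exact Adj.symm this

lemma normInf_le_iff {a : ZVec d} {t : ℕ} : normInf d a ≤ t ↔ ∀ i, (a i).natAbs ≤ t := by
  simp [normInf]

lemma natAbs_le_normInf (a : ZVec d) (i : Fin d) : (a i).natAbs ≤ normInf d a :=
  normInf_le_iff.1 le_rfl i

lemma natAbs_le_norm1 (a : ZVec d) (i : Fin d) : (a i).natAbs ≤ norm1 d a :=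
  Finset.single_le_sum (f := fun i => (a i).natAbs) (fun _ _ => Nat.zero_le _) (Finset.mem_univ i)

lemma norm1_le_mul_normInf (a : ZVec d) : norm1 d a ≤ d * normInf d a := by
  have := Finset.sum_le_card_nsmul Finset.univ (fun i => (a i).natAbs) (normInf d a)
    fun i _ => natAbs_le_normInf a i
  simpa [norm1] using this

lemma Adj.normInf_le {a b : ZVec d} (h : Adj d a b) (c : ZVec d) :
    normInf d (a - c) ≤ normInf d (b - c) + 1 := by
  refine normInf_le_iff.2 fun i => ?_
  have h1 := natAbs_le_normInf (b - c) i
  have h2 := natAbs_le_norm1 (a - b) i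
  rw [Adj] at h
  simp only [Pi.sub_apply] at *
  omega

lemma normInf_sub_le (a b c : ZVec d) :
    normInf d (a - b) ≤ normInf d (a - c) + normInf d (b - c) := by
  refine normInf_le_iff.2 fun i => ?_
  have h1 := natAbs_le_normInf (a - c) i
  have h2 := natAbs_le_normInf (b - c) i
  simp only [Pi.sub_apply] at *
  omega

lemma finite_boxZ (t : ℕ) (c : ZVec d) : (boxZ d t c).Finite := by
  refine (Set.finite_Icc (fun i => c i - t) (fun i => c i + t)).subset fun y hy => ?_
  have h := normInf_le_iff.1 (show normInf d (y - c) ≤ t from hy)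
  simp only [Pi.sub_apply] at h
  exact ⟨fun i => by have := h i; simp only; omega, fun i => by have := h i; simp only; omega⟩

/-- Any two lattice points are joined by a lattice walk of length their `ℓ¹` distance. -/
lemma exists_lattice_walk (a b : ZVec d) :
    ∃ L, IsWalk a b L ∧ (∀ p ∈ pairs L, Adj d p.1 p.2) ∧ (pairs L).length = norm1 d (a - b) := by
  induction h : norm1 d (a - b) generalizing a with
  | zero =>
    have : a = b := by
      funext i
      have := natAbs_le_norm1 (a - b) i
      simp only [Pi.sub_apply] at this
      omega
    subst this
    exact ⟨[a], isWalk_singleton a, by simp, by simp⟩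
  | succ k ih =>
    obtain ⟨i, hi⟩ : ∃ i, a i ≠ b i := by
      by_contra! hcon
      have : a = b := funext hcon
      subst this
      simp [norm1] at h
    set a' : ZVec d := Function.update a i (if a i < b i then a i + 1 else a i - 1) with ha'
    have hsum : norm1 d (a' - b) + 1 = norm1 d (a - b) := by
      simp only [norm1, ← Finset.add_sum_erase _ _ (Finset.mem_univ i)]
      have : ∑ j ∈ Finset.univ.erase i, ((a' - b) j).natAbs
          = ∑ j ∈ Finset.univ.erase i, ((a - b) j).natAbs :=
        Finset.sum_congr rfl fun j hj => by simp [ha', Finset.ne_of_mem_erase hj]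
      rw [this]
      simp only [Pi.sub_apply, ha', Function.update_self]
      split_ifs <;> omega
    have hadj : Adj d a a' := by
      simp only [Adj, norm1, ← Finset.add_sum_erase _ _ (Finset.mem_univ i)]
      have : ∑ j ∈ Finset.univ.erase i, ((a - a') j).natAbs = 0 :=
        Finset.sum_eq_zero fun j hj => by simp [ha', Finset.ne_of_mem_erase hj]
      rw [this]
      simp only [Pi.sub_apply, ha', Function.update_self]
      split_ifs <;> omega
    obtain ⟨L, hL, hadjL, hlen⟩ := ih a' (by omega)
    obtain ⟨L', rfl⟩ := List.head?_eq_some_iff.1 hL.1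
    refine ⟨a :: a' :: L', ⟨rfl, ?_⟩, ?_, ?_⟩
    · simpa [List.getLast?_cons_cons] using hL.2
    · intro p hp
      rcases List.mem_cons.1 hp with rfl | hp
      · exact hadj
      · exact hadjL p hp
    · rw [pairs_cons_cons, List.length_cons, hlen]

lemma IsWalk.ne_nil {α : Type*} {u v : α} {L : List α} (h : IsWalk u v L) : L ≠ [] :=
  List.ne_nil_of_mem h.left_mem

lemma isPath_iff {L : List (ZVec d)} :
    IsPath d L ↔ L ≠ [] ∧ L.Nodup ∧ ∀ p ∈ pairs L, Adj d p.1 p.2 := by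
  rw [IsPath, ← isChain_iff_pairs]
  exact Iff.rfl

lemma isOpenPath_iff {L : List (ZVec d)} :
    IsOpenPath d ω L ↔ ∀ p ∈ pairs L, EdgeOpen d ω p.1 p.2 :=
  isChain_iff_pairs _ _

/-- The truncated cost of a walk as a sum over its edges. -/
lemma pathCost_eq_sum (L : List (ZVec d)) :
    pathCost d n ω L = ((pairs L).map fun p => pairWeight d n ω p.1 p.2).sum := by
  induction L with
  | nil => rfl
  | cons a L ih => cases L <;> simp_all [pathCost]

lemma pairWeight_nonneg (a b : ZVec d) : 0 ≤ pairWeight d n ω a b := by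
  unfold pairWeight; split_ifs <;> positivity

lemma pathCost_mono {L M : List (ZVec d)} (h : (pairs L).Sublist (pairs M)) :
    pathCost d n ω L ≤ pathCost d n ω M := by
  rw [pathCost_eq_sum, pathCost_eq_sum]
  exact (h.map _).sum_le_sum fun _ ha => by
    obtain ⟨p, -, rfl⟩ := List.mem_map.1 ha
    exact pairWeight_nonneg _ _

lemma pathCost_le {L : List (ZVec d)} {c : ℝ}
    (h : ∀ p ∈ pairs L, pairWeight d n ω p.1 p.2 ≤ c) :
    pathCost d n ω L ≤ (pairs L).length * c := by
  rw [pathCost_eq_sum]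
  have := List.sum_le_card_nsmul ((pairs L).map fun p => pairWeight d n ω p.1 p.2) c
    (by simpa using fun _ a b hp he => he ▸ h (a, b) hp)
  simpa using this

lemma le_pathCost {L : List (ZVec d)} {c : ℝ}
    (h : ∀ p ∈ pairs L, c ≤ pairWeight d n ω p.1 p.2) :
    (pairs L).length * c ≤ pathCost d n ω L := by
  rw [pathCost_eq_sum]
  have := List.card_nsmul_le_sum ((pairs L).map fun p => pairWeight d n ω p.1 p.2) c
    (by simpa using fun _ a b hp he => he ▸ h (a, b) hp)
  simpa using this

/-- Segments of a geodesic minimize the cost among all lattice walks with the same ends. -/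
lemma IsGeodesicIn.segment_le {π : List (ZVec d)} (hπ : IsGeodesicIn d n ω Set.univ π)
    {l r : ℕ} (hlr : l ≤ r) (hr : r < π.length) {τ : List (ZVec d)} (hτ : IsWalk π[l] π[r] τ)
    (hadj : ∀ p ∈ pairs τ, Adj d p.1 p.2) :
    pathCost d n ω (segment π l r) ≤ pathCost d n ω τ := by
  obtain ⟨hpath, -, hmin⟩ := hπ
  have hadjπ := (isPath_iff.1 hpath).2.2
  have hw : IsWalk (π.head hpath.1) (π.getLast hpath.1) π :=
    ⟨List.head?_eq_some_head _, List.getLast?_eq_some_getLast _⟩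
  obtain ⟨-, P, Q, hP, hQ, hpairs⟩ := exists_isWalk_segment hw hlr hr
  obtain ⟨A, hA, hpA, -⟩ := hτ.glue hQ
  obtain ⟨B, hB, hpB, -⟩ := hP.glue hA
  obtain ⟨C, hC, hnd, hsub, -⟩ := hB.exists_nodup
  have key := hmin C (isPath_iff.2 ⟨hC.ne_nil, hnd, fun p hp => ?_⟩) (fun _ _ => trivial)
    (hC.1.trans hw.1.symm) (hC.2.trans hw.2.symm)
  · replace key := key.trans (pathCost_mono hsub)
    simp only [pathCost_eq_sum, hpairs, hpB, hpA, List.map_append, List.sum_append] at key ⊢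
    linarith
  · replace hp := hsub.subset hp
    simp only [hpB, hpA, List.mem_append] at hp
    rcases hp with hp | hp | hp
    · exact hadjπ p (by simp [hpairs, hp])
    · exact hadj p hp
    · exact hadjπ p (by simp [hpairs, hp])

/-- Segments of geodesics of the whole lattice are geodesics in every set containing them. -/
lemma IsGeodesicIn.segment {π : List (ZVec d)} (hπ : IsGeodesicIn d n ω Set.univ π)
    {l r : ℕ} (hlr : l ≤ r) (hr : r < π.length) {A : Set (ZVec d)}
    (hA : ∀ v ∈ segment π l r, v ∈ A) : IsGeodesicIn d n ω A (segment π l r) := by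
  have hpath := hπ.1
  have hw : IsWalk (π.head hpath.1) (π.getLast hpath.1) π :=
    ⟨List.head?_eq_some_head _, List.getLast?_eq_some_getLast _⟩
  obtain ⟨hS, P, Q, hP, hQ, hpairs⟩ := exists_isWalk_segment hw hlr hr
  refine ⟨isPath_iff.2 ⟨hS.ne_nil, (isPath_iff.1 hpath).2.1.sublist (segment_sublist _ _ _),
    fun p hp => (isPath_iff.1 hpath).2.2 p (by simp [hpairs, hp])⟩, hA, ?_⟩
  intro τ hτ _ h1 h2
  exact hπ.segment_le hlr hr ⟨h1.trans hS.1, h2.trans hS.2⟩ (isPath_iff.1 hτ).2.2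

lemma normInf_getElem_le {L : List (ZVec d)} (hadj : ∀ p ∈ pairs L, Adj d p.1 p.2) (c : ZVec d)
    (i k : ℕ) (h : i + k < L.length) :
    normInf d (L[i + k] - c) ≤ normInf d (L[i] - c) + k ∧
      normInf d (L[i] - c) ≤ normInf d (L[i + k] - c) + k := by
  induction k with
  | zero => simp
  | succ k ih =>
    have h1 := ih (by omega)
    have h2 : Adj d L[i + k] L[i + k + 1] :=
      hadj (L[i + k], L[i + k + 1]) (mem_pairs_iff_getElem.2 ⟨i + k, by omega, rfl, rfl⟩)
    have h3 := h2.normInf_le c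
    have h4 := h2.symm.normInf_le c
    simp only [← add_assoc]
    omega

/-- `u` and `v` are joined by an open walk inside `U`. -/
def OpenJoined (ω : Config d) (U : Set (ZVec d)) (u v : ZVec d) : Prop :=
  ∃ W, IsWalk u v W ∧ (∀ p ∈ pairs W, EdgeOpen d ω p.1 p.2) ∧ ∀ z ∈ W, z ∈ U

lemma OpenJoined.refl {U : Set (ZVec d)} {u : ZVec d} (hu : u ∈ U) : OpenJoined ω U u u :=
  ⟨[u], isWalk_singleton u, by simp, by simpa using hu⟩

lemma OpenJoined.symm {U : Set (ZVec d)} {u v : ZVec d} (h : OpenJoined ω U u v) :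
    OpenJoined ω U v u := by
  obtain ⟨W, hW, ho, hU⟩ := h
  exact ⟨W.reverse, hW.reverse, fun p hp => (ho _ (mem_pairs_reverse.1 hp)).symm,
    fun z hz => hU z (by simpa using hz)⟩

lemma OpenJoined.trans {U : Set (ZVec d)} {u v w : ZVec d} (h : OpenJoined ω U u v)
    (h' : OpenJoined ω U v w) : OpenJoined ω U u w := by
  obtain ⟨W, hW, ho, hU⟩ := h
  obtain ⟨W', hW', ho', hU'⟩ := h'
  obtain ⟨C, hC, hp, hm⟩ := hW.glue hW'
  refine ⟨C, hC, fun p h => ?_, fun z hz => (hm z hz).elim (hU z) (hU' z)⟩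
  rw [hp] at h
  exact (List.mem_append.1 h).elim (ho p) (ho' p)

lemma OpenJoined.of_edge {U : Set (ZVec d)} {u v : ZVec d} (h : EdgeOpen d ω u v) (hu : u ∈ U)
    (hv : v ∈ U) : OpenJoined ω U u v :=
  ⟨[u, v], ⟨rfl, rfl⟩, by simpa using h, by simp [hu, hv]⟩

lemma OpenJoined.exists_path {U : Set (ZVec d)} {u v : ZVec d} (h : OpenJoined ω U u v) :
    ∃ γ, IsPath d γ ∧ IsOpenPath d ω γ ∧ (∀ z ∈ γ, z ∈ U) ∧
      γ.head? = some u ∧ γ.getLast? = some v := by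
  obtain ⟨W, hW, ho, hU⟩ := h
  obtain ⟨C, hC, hnd, hsub, hss⟩ := hW.exists_nodup
  exact ⟨C, isPath_iff.2 ⟨hC.ne_nil, hnd, fun p hp => (ho p (hsub.subset hp)).adj⟩,
    isOpenPath_iff.2 fun p hp => ho p (hsub.subset hp), fun z hz => hU z (hss hz), hC.1, hC.2⟩

lemma V2.exists_walk {Cstar : ℝ} {e : EdgeD d} {N : ℕ} (h : V2 d Cstar e N ω) {u v : ZVec d}
    (hu : u ∈ boxZ d (3 * N) e.val.1) (hv : v ∈ boxZ d (3 * N) e.val.1)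
    (huv : OpenJoined ω (boxZ d (3 * N) e.val.1) u v) :
    ∃ W, IsWalk u v W ∧ (∀ p ∈ pairs W, EdgeOpen d ω p.1 p.2) ∧
      (∀ z ∈ W, z ∈ boxZ d (4 * N) e.val.1) ∧ ((pairs W).length : ℝ) ≤ Cstar * N := by
  obtain ⟨W, hp, ho, hU, h1, h2, hl⟩ := h u v hu hv huv.exists_path
  refine ⟨W, ⟨h1, h2⟩, isOpenPath_iff.1 ho, hU, ?_⟩
  have : 1 ≤ W.length := List.length_pos_iff.2 hp.1
  rw [length_pairs, Nat.cast_sub this]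
  simpa using hl

lemma one_le_log_sq {n : ℕ} (hn : 3 ≤ n) : 1 ≤ (Real.log n) ^ 2 := by
  have h1 : (1 : ℝ) ≤ Real.log n := by
    rw [Real.le_log_iff_exp_le (by positivity)]
    have : (3 : ℝ) ≤ n := by exact_mod_cast hn
    linarith [Real.exp_one_lt_d9]
  nlinarith

/-- A geodesic segment between openly connected points of `Λ_{3N}(e)` stays in the large box. -/
lemma IsGeodesicIn.getElem_mem_boxR {π : List (ZVec d)} (hπ : IsGeodesicIn d n ω Set.univ π)
    (hn : 2 ≤ n) {Cstar : ℝ} {e : EdgeD d} {N : ℕ} (hC : 6 ≤ Cstar) (hCd : 8 * (d : ℝ) + 3 ≤ Cstar)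
    (hV2 : V2 d Cstar e N ω) {i k : ℕ} (hik : i ≤ k) (hk : k < π.length)
    (hi : π[i] ∈ boxZ d (3 * N) e.val.1) (hk' : π[k] ∈ boxZ d (3 * N) e.val.1)
    (hconn : OpenJoined ω (boxZ d (3 * N) e.val.1) π[i] π[k]) {m : ℕ} (him : i ≤ m) (hmk : m ≤ k) :
    π[m] ∈ boxR d (Cstar * N) e.val.1 := by
  have hadj := (isPath_iff.1 hπ.1).2.2
  have hlen : (pairs (Perco.segment π i k)).length = k - i := by
    rw [length_pairs, length_segment hk]; omega
  have hb1 := (normInf_getElem_le hadj e.val.1 i (m - i) (by omega)).1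
  have hb2 := (normInf_getElem_le hadj e.val.1 m (k - m) (by omega)).2
  simp only [Nat.add_sub_cancel' him, Nat.add_sub_cancel' hmk] at hb1 hb2
  change normInf d _ ≤ 3 * N at hi hk'
  have hb : 2 * normInf d (π[m] - e.val.1) ≤ 6 * N + (k - i) := by omega
  have hb' : 2 * (normInf d (π[m] - e.val.1) : ℝ) ≤ 6 * N + ((k - i : ℕ) : ℝ) := by
    exact_mod_cast hb
  suffices h : 6 * (N : ℝ) + ((k - i : ℕ) : ℝ) ≤ 2 * (Cstar * N) by
    change (normInf d _ : ℝ) ≤ _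
    linarith
  have hN : (0 : ℝ) ≤ N := Nat.cast_nonneg N
  rcases Nat.lt_or_ge n 3 with hn3 | hn3
  · obtain rfl : n = 2 := by omega
    obtain ⟨τ, hτ, hτadj, hτlen⟩ := exists_lattice_walk π[i] π[k]
    have hcost := hπ.segment_le hik hk hτ hτadj
    have hlog1 : (0.69 : ℝ) ≤ Real.log 2 := by linarith [Real.log_two_gt_d9]
    have hlog2 : Real.log 2 ≤ 0.7 := by linarith [Real.log_two_lt_d9]
    have hsq1 : (0.4 : ℝ) ≤ (Real.log ((2 : ℕ) : ℝ)) ^ 2 := by push_cast; nlinarith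
    have hsq2 : (Real.log ((2 : ℕ) : ℝ)) ^ 2 ≤ 1 := by push_cast; nlinarith
    have hlow := le_pathCost (n := 2) (ω := ω) (L := Perco.segment π i k) (c := 0.4) fun p _ => by
      unfold pairWeight; split_ifs
      · norm_num
      · exact hsq1
    have hup := pathCost_le (n := 2) (ω := ω) (L := τ) (c := 1) fun p _ => by
      unfold pairWeight; split_ifs
      · exact le_rfl
      · exact hsq2
    have hdist : norm1 d (π[i] - π[k]) ≤ d * (6 * N) :=
      (norm1_le_mul_normInf _).trans (Nat.mul_le_mul_left d
        ((normInf_sub_le _ _ e.val.1).trans (by omega)))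
    have hdist' : (norm1 d (π[i] - π[k]) : ℝ) ≤ d * (6 * N) := by exact_mod_cast hdist
    rw [hlen] at hlow
    rw [hτlen] at hup
    nlinarith [mul_le_mul_of_nonneg_right hCd hN]
  · obtain ⟨τ, hτ, hτo, -, hτlen⟩ := hV2.exists_walk hi hk' hconn
    have hcost := hπ.segment_le hik hk hτ fun p hp => (hτo p hp).adj
    have hlow := le_pathCost (n := n) (ω := ω) (L := Perco.segment π i k) (c := 1) fun p _ => by
      unfold pairWeight; split_ifs
      · exact le_rfl
      · exact one_le_log_sq hn3
    have hup := pathCost_le (n := n) (ω := ω) (L := τ) (c := 1) fun p hp => by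
      unfold pairWeight; rw [if_pos (hτo p hp)]
    rw [hlen] at hlow
    nlinarith [mul_le_mul_of_nonneg_right hC hN]

lemma boxZ_subset_boxR {Cstar : ℝ} {c : ZVec d} {N : ℕ} (hC : 6 ≤ Cstar) {z : ZVec d}
    (hz : z ∈ boxZ d (3 * N) c) : z ∈ boxR d (Cstar * N) c := by
  change normInf d _ ≤ _ at hz
  change (normInf d _ : ℝ) ≤ _
  have : (normInf d (z - c) : ℝ) ≤ 3 * N := by exact_mod_cast hz
  have hN : (0 : ℝ) ≤ N := Nat.cast_nonneg N
  nlinarith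

/-- Either a list all of whose edges are open or on `π` is open, or there is an interval of
indices of `π` staying in the large box and containing all closed edges of the list. -/
lemma IsGeodesicIn.exists_interval {π : List (ZVec d)} (hπ : IsGeodesicIn d n ω Set.univ π)
    (hn : 2 ≤ n) {Cstar : ℝ} {e : EdgeD d} {N : ℕ} (hC : 6 ≤ Cstar) (hCd : 8 * (d : ℝ) + 3 ≤ Cstar)
    (hV2 : V2 d Cstar e N ω) (L : List (ZVec d)) {u : ZVec d} (hu : L.head? = some u)
    (hbox : ∀ z ∈ L, z ∈ boxZ d (3 * N) e.val.1)
    (hL : ∀ p ∈ pairs L, EdgeOpen d ω p.1 p.2 ∨ edgeMemPath d p.1 p.2 π) :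
    (∀ p ∈ pairs L, EdgeOpen d ω p.1 p.2) ∨
    ∃ l j r, ∃ _ : l ≤ j, ∃ _ : j ≤ r, ∃ hr : r < π.length,
      (∀ m (_ : l ≤ m) (_ : m ≤ r), π[m] ∈ boxR d (Cstar * N) e.val.1) ∧
      OpenJoined ω (boxZ d (3 * N) e.val.1) u π[j] ∧ π[j] ∈ boxZ d (3 * N) e.val.1 ∧
      ∀ p ∈ pairs L, ¬ EdgeOpen d ω p.1 p.2 → edgeMemPath d p.1 p.2 (Perco.segment π l r) := by
  induction L generalizing u with
  | nil => simp at hu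
  | cons a L ih =>
    obtain rfl : a = u := by simpa using hu
    cases L with
    | nil => left; simp
    | cons b L =>
      have ha := hbox a (by simp)
      have hb := hbox b (by simp)
      have ih := ih (u := b) rfl (fun z hz => hbox z (List.mem_cons_of_mem _ hz))
        (fun p hp => hL p (List.mem_cons_of_mem _ hp))
      by_cases hab : EdgeOpen d ω a b
      · rcases ih with ih | ⟨l, j, r, hlj, hjr, hr, h1, h2, h3, h4⟩
        · left
          intro p hp
          rcases List.mem_cons.1 hp with rfl | hp
          · exact hab
          · exact ih p hp
        · right
          refine ⟨l, j, r, hlj, hjr, hr, h1, (OpenJoined.of_edge hab ha hb).trans h2, h3, ?_⟩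
          intro p hp hnp
          rcases List.mem_cons.1 hp with rfl | hp
          · exact absurd hab hnp
          · exact h4 p hp hnp
      · right
        obtain ⟨ia, ib, hia, hib, hpa, hpb, hadj⟩ : ∃ ia ib, ∃ hia : ia < π.length,
            ∃ hib : ib < π.length, π[ia] = a ∧ π[ib] = b ∧ (ib = ia + 1 ∨ ia = ib + 1) := by
          rcases (hL (a, b) (by simp)).resolve_left hab with h | h
          · obtain ⟨i, hi, h1, h2⟩ := mem_pairs_iff_getElem.1 h
            exact ⟨i, i + 1, by omega, hi, h1, h2, Or.inl rfl⟩
          · obtain ⟨i, hi, h1, h2⟩ := mem_pairs_iff_getElem.1 h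
            exact ⟨i + 1, i, hi, by omega, h2, h1, Or.inr rfl⟩
        have hmemab : ∀ l r, l ≤ ia → l ≤ ib → ia ≤ r → ib ≤ r → ∀ hr : r < π.length,
            edgeMemPath d a b (Perco.segment π l r) := by
          intro l r h1 h2 h3 h4 hr
          rcases hadj with rfl | rfl
          · left
            rw [← hpa, ← hpb]
            exact mem_pairs_segment hr h1 (by omega)
          · right
            rw [← hpa, ← hpb]
            exact mem_pairs_segment hr h2 (by omega)
        have hab_box : ∀ m (hm : m < π.length), m = ia ∨ m = ib →
            π[m] ∈ boxR d (Cstar * N) e.val.1 := by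
          rintro m hm (rfl | rfl)
          · rw [hpa]; exact boxZ_subset_boxR hC ha
          · rw [hpb]; exact boxZ_subset_boxR hC hb
        rcases ih with ih | ⟨l, j, r, hlj, hjr, hr, h1, h2, h3, h4⟩
        · refine ⟨min ia ib, ia, max ia ib, by omega, by omega, by omega, ?_, ?_, ?_, ?_⟩
          · intro m hm1 hm2
            exact hab_box m (by omega) (by omega)
          · rw [hpa]; exact OpenJoined.refl ha
          · rw [hpa]; exact ha
          · intro p hp hnp
            rcases List.mem_cons.1 hp with rfl | hp
            · exact hmemab _ _ (by omega) (by omega) (by omega) (by omega) (by omega)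
            · exact absurd (ih p hp) hnp
        · refine ⟨min l (min ia ib), ia, max r (max ia ib), by omega, by omega, by omega,
            ?_, ?_, ?_, ?_⟩
          · intro m hm1 hm2
            by_cases hm3 : l ≤ m ∧ m ≤ r
            · exact h1 m hm3.1 hm3.2
            by_cases hm4 : m = ia ∨ m = ib
            · exact hab_box m (by omega) hm4
            rcases le_total j ib with hjb | hjb
            · refine hπ.getElem_mem_boxR hn hC hCd hV2 hjb hib h3 (by rwa [hpb]) ?_
                (m := m) (by omega) (by omega)
              rw [hpb]; exact h2.symm
            · refine hπ.getElem_mem_boxR hn hC hCd hV2 hjb (by omega) (by rwa [hpb]) h3 ?_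
                (m := m) (by omega) (by omega)
              rw [hpb]; exact h2
          · rw [hpa]; exact OpenJoined.refl ha
          · rw [hpa]; exact ha
          · intro p hp hnp
            rcases List.mem_cons.1 hp with rfl | hp
            · exact hmemab _ _ (by omega) (by omega) (by omega) (by omega) (by omega)
            · have hmono : ∀ q ∈ pairs (Perco.segment π l r),
                  q ∈ pairs (Perco.segment π (min l (min ia ib)) (max r (max ia ib))) := by
                rintro ⟨q1, q2⟩ hq
                obtain ⟨i, hi, rfl, rfl⟩ := mem_pairs_iff_getElem.1 hq
                rw [length_segment hr] at hi
                have := mem_pairs_segment (L := π) (l := min l (min ia ib))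
                  (r := max r (max ia ib)) (m := l + i) (by omega) (by omega) (by omega)
                simpa [Perco.segment, add_assoc] using this
              exact (h4 p hp hnp).imp (hmono _) (hmono _)

/-- Paths in `Λ_{3N}(e)` whose closed edges lie on a geodesic are modified geodesics of the
large box. -/
lemma IsGeodesicIn.gstarIn {π : List (ZVec d)} (hπ : IsGeodesicIn d n ω Set.univ π)
    (hn : 2 ≤ n) {Cstar : ℝ} {e : EdgeD d} {N : ℕ} (hC : 6 ≤ Cstar) (hCd : 8 * (d : ℝ) + 3 ≤ Cstar)
    (hV2 : V2 d Cstar e N ω) {L : List (ZVec d)} (hpath : IsPath d L)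
    (hbox : ∀ z ∈ L, z ∈ boxZ d (3 * N) e.val.1)
    (hL : ∀ p ∈ pairs L, EdgeOpen d ω p.1 p.2 ∨ edgeMemPath d p.1 p.2 π) :
    GstarIn d n ω (boxR d (Cstar * N) e.val.1) L := by
  refine ⟨hpath, fun z hz => boxZ_subset_boxR hC (hbox z hz), ?_⟩
  have hu : L.head? = some (L.head hpath.1) := List.head?_eq_some_head _
  rcases hπ.exists_interval hn hC hCd hV2 L hu hbox hL with
    h | ⟨l, j, r, hlj, hjr, hr, h1, -, -, h4⟩
  · refine ⟨[L.head hpath.1], ⟨isPath_iff.2 ⟨by simp, by simp, by simp⟩, ?_, ?_⟩, ?_⟩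
    · intro v hv
      obtain rfl := List.mem_singleton.1 hv
      exact boxZ_subset_boxR hC (hbox _ (List.head_mem _))
    · intro τ _ _ _ _
      rw [pathCost_eq_sum τ]
      exact List.sum_nonneg fun _ ha => by
        obtain ⟨p, -, rfl⟩ := List.mem_map.1 ha
        exact pairWeight_nonneg _ _
    · rintro a b (hab | hab) -
      · exact h _ hab
      · exact (h _ hab).symm
  · refine ⟨Perco.segment π l r, hπ.segment (hlj.trans hjr) hr ?_, ?_⟩
    · intro v hv
      obtain ⟨m, hm, hm1, hm2, rfl⟩ := mem_segment hr hv
      exact h1 m hm1 hm2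
    · rintro a b (hab | hab) hn
      · by_contra hcon
        exact hn (h4 _ hab hcon)
      · by_contra hcon
        exact hn (h4 _ hab fun h => hcon h.symm).symm

lemma InInfCluster.exists_openJoined {x : ZVec d} (hx : InInfCluster d ω x) {U : Set (ZVec d)}
    (hU : U.Finite) : ∃ w, w ∉ U ∧ OpenJoined ω Set.univ x w := by
  obtain ⟨w, hw, hwU⟩ := hx.exists_notMem_finite hU
  refine ⟨w, hwU, ?_⟩
  have hne : {k : ℕ∞ | ∃ γ : List (ZVec d), IsPath d γ ∧ IsOpenPath d ω γ ∧
      (∀ v ∈ γ, v ∈ (Set.univ : Set (ZVec d))) ∧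
      γ.head? = some x ∧ γ.getLast? = some w ∧ ((γ.length - 1 : ℕ) : ℕ∞) = k}.Nonempty := by
    rw [Set.nonempty_iff_ne_empty]
    intro h
    apply hw
    rw [chemDist, chemDistIn, h, sInf_empty]
  obtain ⟨-, γ, -, ho, -, h1, h2, -⟩ := hne
  exact ⟨γ, ⟨h1, h2⟩, isOpenPath_iff.1 ho, fun _ _ => trivial⟩

/-- A modified geodesic started at `x` and visiting `Λ_N(e)` yields a modified geodesic crossing
the annulus, each vertex of which is reached from `x` either along the initial portion of the
geodesic that avoids `Λ_N(e)`, or by an open walk inside `Λ_{3N}(e)`. -/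
lemma IsGeodesicIn.exists_crossing {π : List (ZVec d)} (hπ : IsGeodesicIn d n ω Set.univ π)
    (hn : 2 ≤ n) {Cstar : ℝ} {e : EdgeD d} {N : ℕ} (hN : 1 ≤ N) (hC : 6 ≤ Cstar)
    (hCd : 8 * (d : ℝ) + 3 ≤ Cstar) (hV2 : V2 d Cstar e N ω) {x y : ZVec d}
    (hx : InInfCluster d ω x) {γ : List (ZVec d)} (hpath : IsPath d γ) (hγ : IsWalk x y γ)
    (hγπ : ∀ p ∈ pairs γ, EdgeOpen d ω p.1 p.2 ∨ edgeMemPath d p.1 p.2 π)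
    (hvisit : ∃ z ∈ γ, z ∈ boxZ d N e.val.1) :
    ∃ γ₁, GstarIn d n ω (boxR d (Cstar * N) e.val.1) γ₁ ∧ IsCrossing d N e γ₁ ∧
      ∀ u ∈ γ₁,
        (∃ W, IsWalk x u W ∧ ∀ p ∈ pairs W, p ∈ pairs γ ∧ p.1 ∉ boxZ d N e.val.1) ∨
        OpenJoined ω (boxZ d (3 * N) e.val.1) x u := by
  obtain ⟨-, hnd, hadj⟩ := isPath_iff.1 hpath
  obtain ⟨B, z, C, rfl, hz, hB⟩ := exists_first hvisit
  have hinit : ∀ u ∈ B, ∃ W, IsWalk x u W ∧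
      ∀ p ∈ pairs W, p ∈ pairs (B ++ z :: C) ∧ p.1 ∉ boxZ d N e.val.1 := by
    intro u hu
    obtain ⟨S, T, rfl⟩ := List.append_of_mem hu
    refine ⟨S ++ [u], ⟨?_, by simp⟩, fun p hp => ⟨?_, hB _ ?_⟩⟩
    · have := hγ.1
      cases S <;> simpa using this
    · rw [List.append_assoc, List.cons_append, pairs_append_cons]
      exact List.mem_append_left _ hp
    · have := (mem_of_mem_pairs hp).1
      simp only [List.mem_append, List.mem_cons, List.not_mem_nil, or_false] at this ⊢
      tauto
  have hBpairs : ∀ p ∈ pairs B, p ∈ pairs (B ++ z :: C) := fun p hp => by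
    rcases B.eq_nil_or_concat with rfl | ⟨B', t, rfl⟩
    · simp at hp
    · rw [List.concat_eq_append, List.append_assoc, List.singleton_append, pairs_append_cons]
      exact List.mem_append_left _ (by simpa using hp)
  have hBlast : ∀ t ∈ B.getLast?, normInf d (t - e.val.1) ≤ N + 1 := by
    intro t ht
    obtain ⟨B', rfl⟩ := List.getLast?_eq_some_iff.1 ht
    have : Adj d t z := hadj (t, z) (by
      rw [List.append_assoc, List.singleton_append, pairs_append_cons]; simp)
    exact (this.normInf_le e.val.1).trans (Nat.add_le_add_right hz 1)
  simp only [boxZ, Set.mem_ofPred_eq, not_le] at hB hz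
  by_cases hout : ∃ t ∈ B, 3 * N < normInf d (t - e.val.1)
  · obtain ⟨B₁, t, B₂, rfl, ht, hB₂⟩ := exists_last hout
    cases B₂ with
    | nil => have := hBlast t (by simp); omega
    | cons s B₃ =>
      have hts : Adj d t s := hadj (t, s) (hBpairs _ (by rw [pairs_append_cons]; simp))
      have hs := hts.normInf_le e.val.1
      have hs' := hB₂ s (by simp)
      have hann : ∀ v ∈ s :: B₃, v ∈ annulus d N e := fun v hv =>
        ⟨not_lt.1 (hB₂ v hv), hB v (by simp at hv ⊢; tauto)⟩
      have hsub : ∀ p ∈ pairs (s :: B₃), p ∈ pairs (B₁ ++ t :: s :: B₃ ++ z :: C) := fun p hp =>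
        hBpairs _ (by rw [pairs_append_cons]; simp [hp])
      have hpath₁ : IsPath d (s :: B₃) := by
        refine isPath_iff.2 ⟨by simp, hnd.sublist ?_, fun p hp => hadj p (hsub p hp)⟩
        refine List.Sublist.trans ?_ (List.sublist_append_left _ _)
        exact (List.sublist_cons_self _ _).trans (List.sublist_append_right _ _)
      refine ⟨s :: B₃, hπ.gstarIn hn hC hCd hV2 hpath₁ (fun v hv => (hann v hv).1)
        fun p hp => hγπ p (hsub p hp), ⟨hpath₁, hann, ?_, s, by simp, by omega⟩, ?_⟩
      · refine ⟨(s :: B₃).getLast (by simp), List.getLast_mem _, ?_⟩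
        have h1 := hBlast ((s :: B₃).getLast (by simp)) (by
          simp [List.getLast?_eq_some_getLast])
        have h2 := (hann _ (List.getLast_mem (l := s :: B₃) (by simp))).2
        omega
      · intro u hu
        exact Or.inl (hinit u (by simp at hu ⊢; tauto))
  · push Not at hout
    have hxmem : x ∈ boxZ d (3 * N) e.val.1 := by
      have := hγ.1
      change normInf d _ ≤ _
      cases B with
      | nil => obtain rfl : z = x := by simpa using this
               omega
      | cons b B => obtain rfl : b = x := by simpa using this
                    exact hout b (by simp)
    obtain ⟨w, hw, hxw⟩ := hx.exists_openJoined (finite_boxZ (3 * N) e.val.1)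
    obtain ⟨σ, hσpath, hσo, -, hσ1, hσ2⟩ := hxw.exists_path
    rw [isOpenPath_iff] at hσo
    have hσnd := hσpath.2.1
    obtain ⟨S, w', T, rfl, hw', hS⟩ := exists_first (P := fun v => v ∉ boxZ d (3 * N) e.val.1)
      ⟨w, List.mem_of_getLast? hσ2, hw⟩
    simp only [not_not] at hS
    rcases S.eq_nil_or_concat with rfl | ⟨S', s, hS'⟩
    · obtain rfl : w' = x := by simpa using hσ1
      exact absurd hxmem hw'
    rw [List.concat_eq_append] at hS'
    have hSwalk : IsWalk x s S := by
      subst hS'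
      refine ⟨?_, by simp⟩
      cases S' <;> simpa using hσ1
    have hSo : ∀ p ∈ pairs S, EdgeOpen d ω p.1 p.2 := fun p hp => hσo p (by
      subst hS'
      rw [List.append_assoc, List.singleton_append, pairs_append_cons]
      exact List.mem_append_left _ hp)
    have hsw : EdgeOpen d ω s w' := hσo (s, w') (by
      subst hS'
      rw [List.append_assoc, List.singleton_append, pairs_append_cons]; simp)
    have hSjoin : ∀ u ∈ S, OpenJoined ω (boxZ d (3 * N) e.val.1) x u := by
      intro u hu
      obtain ⟨W, W', hW, -, hp, hsub, -⟩ := hSwalk.split hu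
      exact ⟨W, hW, fun p h => hSo p (by rw [hp]; exact List.mem_append_left _ h),
        fun v hv => hS v (hsub hv)⟩
    have hs : normInf d (s - e.val.1) = 3 * N := by
      have h1 := hS s hSwalk.right_mem
      have h2 := hsw.adj.symm.normInf_le e.val.1
      simp only [boxZ, Set.mem_ofPred_eq] at h1 hw'
      omega
    have hSnd : S.Nodup := (List.nodup_append.1 hσnd).1
    by_cases hin : ∃ t ∈ S, normInf d (t - e.val.1) ≤ N
    · obtain ⟨S₁, t, S₂, rfl, ht, hS₂⟩ := exists_last hin
      cases S₂ with
      | nil =>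
        obtain rfl : t = s := by simpa using hSwalk.2
        omega
      | cons q S₃ =>
        have hsub : ∀ p ∈ pairs (q :: S₃), EdgeOpen d ω p.1 p.2 := fun p hp =>
          hSo _ (by rw [pairs_append_cons]; simp [hp])
        have htq : EdgeOpen d ω t q := hSo (t, q) (by rw [pairs_append_cons]; simp)
        have hq := htq.adj.symm.normInf_le e.val.1
        have hq' := hS₂ q (by simp)
        have hann : ∀ v ∈ q :: S₃, v ∈ annulus d N e := fun v hv =>
          ⟨hS v (by simp at hv ⊢; tauto), not_le.1 (hS₂ v hv)⟩
        have hpath₁ : IsPath d (q :: S₃) := by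
          refine isPath_iff.2 ⟨by simp, hSnd.sublist ?_, fun p hp => (hsub p hp).adj⟩
          exact (List.sublist_cons_self _ _).trans (List.sublist_append_right _ _)
        refine ⟨q :: S₃, hπ.gstarIn hn hC hCd hV2 hpath₁ (fun v hv => (hann v hv).1)
          fun p hp => Or.inl (hsub p hp), ⟨hpath₁, hann, ⟨q, by simp, by omega⟩, s, ?_, hs⟩, ?_⟩
        · have := hSwalk.2
          exact List.mem_of_getLast? (by
            simpa [List.getLast?_append, List.getLast?_cons_cons] using this)
        · intro u hu
          exact Or.inr (hSjoin u (by simp at hu ⊢; tauto))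
    · push Not at hin
      rcases B.eq_nil_or_concat with rfl | ⟨B', t, hB'⟩
      · obtain rfl : z = x := by simpa using hγ.1
        have := hin z hSwalk.left_mem
        omega
      rw [List.concat_eq_append] at hB'
      have hBwalk : IsWalk x t B := by
        subst hB'
        refine ⟨?_, by simp⟩
        have := hγ.1
        cases B' <;> simpa using this
      obtain ⟨A, hA, hpA, hmA⟩ := hSwalk.reverse.glue hBwalk
      obtain ⟨D, hD, hDnd, hpD, hDA⟩ := hA.exists_nodup
      have hmem : ∀ v ∈ D, v ∈ S ∨ v ∈ B := fun v hv => by simpa using hmA v (hDA hv)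
      have hann : ∀ v ∈ D, v ∈ annulus d N e := fun v hv =>
        (hmem v hv).elim (fun h => ⟨hS v h, hin v h⟩) (fun h => ⟨hout v h, hB v h⟩)
      have hedge : ∀ p ∈ pairs D, EdgeOpen d ω p.1 p.2 ∨ p ∈ pairs (B ++ z :: C) := by
        intro p hp
        have := hpD.subset hp
        rw [hpA, List.mem_append, mem_pairs_reverse] at this
        exact this.imp (fun h => (hSo _ h).symm) (hBpairs p)
      have hpath₁ : IsPath d D := isPath_iff.2 ⟨hD.ne_nil, hDnd, fun p hp =>
        (hedge p hp).elim EdgeOpen.adj (hadj p)⟩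
      refine ⟨D, hπ.gstarIn hn hC hCd hV2 hpath₁ (fun v hv => (hann v hv).1)
        fun p hp => (hedge p hp).elim Or.inl (hγπ p),
        ⟨hpath₁, hann, ⟨t, hD.right_mem, ?_⟩, s, hD.left_mem, hs⟩, ?_⟩
      · have h1 := hBlast t hBwalk.2
        have h2 := (hann t hD.right_mem).2
        omega
      · intro u hu
        exact (hmem u hu).symm.imp (hinit u) (hSjoin u)

/-- Splicing an open walk into a modified geodesic. -/
lemma GstarIn.splice {γ : List (ZVec d)} (hγ : GstarIn d n ω Set.univ γ) {c : ZVec d} {N : ℕ}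
    {x u v y : ZVec d} {W₁ M W₂ : List (ZVec d)} (h₁ : IsWalk x u W₁) (hM : IsWalk u v M)
    (h₂ : IsWalk v y W₂)
    (hγ₁ : ∀ p ∈ pairs W₁, edgeMemPath d p.1 p.2 γ ∧ ¬ (p.1 ∈ boxZ d N c ∧ p.2 ∈ boxZ d N c))
    (hγ₂ : ∀ p ∈ pairs W₂, edgeMemPath d p.1 p.2 γ ∧ ¬ (p.1 ∈ boxZ d N c ∧ p.2 ∈ boxZ d N c))
    (hMo : ∀ p ∈ pairs M, EdgeOpen d ω p.1 p.2) (hMbox : ∀ z ∈ M, z ∈ boxZ d (4 * N) c) :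
    ∃ η : List (ZVec d), GstarIn d n ω Set.univ η ∧ η.head? = some x ∧ η.getLast? = some y ∧
      (∀ a b : ZVec d, edgeMemPath d a b η → ¬ EdgeOpen d ω a b →
        ¬ (a ∈ boxZ d N c ∧ b ∈ boxZ d N c)) ∧
      (∀ a b : ZVec d, edgeMemPath d a b η → ¬ edgeMemPath d a b γ →
        EdgeOpen d ω a b ∧ a ∈ boxZ d (4 * N) c ∧ b ∈ boxZ d (4 * N) c) ∧
      diffEdgeCount d η γ ≤ (pairs M).length := by
  obtain ⟨A, hA, hpA, -⟩ := hM.glue h₂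
  obtain ⟨A', hA', hpA', -⟩ := h₁.glue hA
  obtain ⟨η, hη, hnd, hsub, -⟩ := hA'.exists_nodup
  obtain ⟨hpath, -, π, hπ, hγπ⟩ := hγ
  have hadj := (isPath_iff.1 hpath).2.2
  rw [hpA', hpA] at hsub
  have hedge' : ∀ p ∈ pairs η,
      (edgeMemPath d p.1 p.2 γ ∧ ¬ (p.1 ∈ boxZ d N c ∧ p.2 ∈ boxZ d N c)) ∨
      (EdgeOpen d ω p.1 p.2 ∧ p.1 ∈ boxZ d (4 * N) c ∧ p.2 ∈ boxZ d (4 * N) c) := by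
    intro p hp
    rcases List.mem_append.1 (hsub.subset hp) with h | h
    · exact Or.inl (hγ₁ p h)
    rcases List.mem_append.1 h with h | h
    · have := mem_of_mem_pairs h
      exact Or.inr ⟨hMo p h, hMbox _ this.1, hMbox _ this.2⟩
    · exact Or.inl (hγ₂ p h)
  have hedge : ∀ a b, edgeMemPath d a b η →
      (edgeMemPath d a b γ ∧ ¬ (a ∈ boxZ d N c ∧ b ∈ boxZ d N c)) ∨
      (EdgeOpen d ω a b ∧ a ∈ boxZ d (4 * N) c ∧ b ∈ boxZ d (4 * N) c) := by
    rintro a b (h | h)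
    · exact hedge' _ h
    · exact (hedge' _ h).imp (fun h => ⟨h.1.symm, fun h' => h.2 h'.symm⟩)
        fun h => ⟨h.1.symm, h.2.symm⟩
  refine ⟨η, ⟨isPath_iff.2 ⟨hη.ne_nil, hnd, fun p hp => ?_⟩, fun _ _ => trivial, π, hπ, ?_⟩,
    hη.1, hη.2, ?_, ?_, ?_⟩
  · rcases hedge' p hp with ⟨h | h, -⟩ | h
    · exact hadj _ h
    · exact (hadj _ h).symm
    · exact h.1.adj
  · intro a b hab hn
    exact (hedge a b hab).elim (fun h => hγπ a b h.1 hn) fun h => h.1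
  · intro a b hab hn
    exact (hedge a b hab).elim (fun h => h.2) fun h => absurd h.1 hn
  · intro a b hab hn
    exact (hedge a b hab).elim (fun h => absurd h.1 hn) id
  · set q : ZVec d × ZVec d → Bool := fun pr => decide (¬ edgeMemPath d pr.1 pr.2 γ)
    have hnil : ∀ W : List (ZVec d), (∀ p ∈ pairs W, edgeMemPath d p.1 p.2 γ) →
        (pairs W).filter q = [] := fun W hW =>
      List.filter_eq_nil_iff.2 fun p hp => by simpa [q] using hW p hp
    have := (hsub.filter q).length_le
    rw [List.filter_append, List.filter_append, hnil W₁ fun p hp => (hγ₁ p hp).1,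
      hnil W₂ fun p hp => (hγ₂ p hp).1, List.nil_append, List.append_nil] at this
    exact this.trans (List.length_filter_le _ _)

end Lattice

/-- Proposition 2.6: bypass of a closed edge.
If `x, y ∈ C_∞`, `γ ∈ 𝔾_*(x,y)` and `e` is a closed edge of `γ` such that not both `x`
and `y` lie in `Λ_{3R_e}(e)`, then there is `η_e ∈ 𝔾_*(x,y)` such that (i) no closed
edge of `η_e` lies in `Λ_{R_e}(e)` and `η_e \ γ` is open and contained in `Λ_{4R_e}(e)`,
and (ii) `|η_e \ γ| ≤ 2 C_* R_e`. -/
theorem bypass_of_closed_edge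
    (d n : ℕ) (hd : 2 ≤ d) (hn : 2 ≤ n)
    (ρ cs Cstar : ℝ) (hρ : 1 ≤ ρ) (hcs0 : 0 < cs) (hcs1 : cs < 1)
    (hC : Cstar = 1 / cs + (100 * ρ ^ 2) ^ d)
    (ω : Config d) (x y : ZVec d)
    (hxinf : InInfCluster d ω x) (hyinf : InInfCluster d ω y)
    (γ : List (ZVec d))
    (hγ : GstarIn d n ω Set.univ γ) (hhead : γ.head? = some x) (hlast : γ.getLast? = some y)
    (e : EdgeD d) (he : edgeMemPath d e.val.1 e.val.2 γ) (hclosed : ω e = false)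
    (hfin : ∃ N : ℕ, 1 ≤ N ∧ V1 d Cstar n e N ω ∧ V2 d Cstar e N ω)
    (hxy : ¬ (x ∈ boxZ d (3 * ReffN d Cstar n e ω) e.val.1 ∧
              y ∈ boxZ d (3 * ReffN d Cstar n e ω) e.val.1)) :
    ∃ η : List (ZVec d), GstarIn d n ω Set.univ η ∧
      η.head? = some x ∧ η.getLast? = some y ∧
      (∀ a b : ZVec d, edgeMemPath d a b η → ¬ EdgeOpen d ω a b →
        ¬ (a ∈ boxZ d (ReffN d Cstar n e ω) e.val.1 ∧
           b ∈ boxZ d (ReffN d Cstar n e ω) e.val.1)) ∧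
      (∀ a b : ZVec d, edgeMemPath d a b η → ¬ edgeMemPath d a b γ →
        EdgeOpen d ω a b ∧ a ∈ boxZ d (4 * ReffN d Cstar n e ω) e.val.1 ∧
        b ∈ boxZ d (4 * ReffN d Cstar n e ω) e.val.1) ∧
      (diffEdgeCount d η γ : ℝ) ≤ 2 * Cstar * ReffN d Cstar n e ω := by
  set N := ReffN d Cstar n e ω with hNdef
  obtain ⟨hN, hV1, hV2⟩ : 1 ≤ N ∧ V1 d Cstar n e N ω ∧ V2 d Cstar e N ω := Nat.sInf_mem hfin
  have hCbig : 1 + 100 * (d : ℝ) ≤ Cstar := by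
    have h1 : 1 ≤ 1 / cs := (one_le_div hcs0).2 hcs1.le
    have h2 : (100 : ℝ) ^ d ≤ (100 * ρ ^ 2) ^ d := by
      gcongr; nlinarith
    have h4 : (100 : ℝ) * d ≤ 100 ^ d := by
      obtain ⟨k, rfl⟩ : ∃ k, d = k + 1 := ⟨d - 1, by omega⟩
      have h5 : 1 + (k : ℝ) * 99 ≤ (1 + 99) ^ k := one_add_mul_le_pow (by norm_num) k
      have h6 : (0 : ℝ) ≤ k := Nat.cast_nonneg k
      rw [pow_succ]
      push_cast
      norm_num at h5
      linarith
    linarith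
  have hd' : (2 : ℝ) ≤ d := by exact_mod_cast hd
  have hC6 : 6 ≤ Cstar := by linarith
  have hCd : 8 * (d : ℝ) + 3 ≤ Cstar := by linarith
  have hNC : 0 ≤ Cstar * N := by positivity
  obtain ⟨π, hπ, hγπ⟩ := hγ.2.2
  have hpath := hγ.1
  obtain ⟨hne, hnd, hadj⟩ := isPath_iff.1 hpath
  have hwalk : IsWalk x y γ := ⟨hhead, hlast⟩
  have hedge : ∀ p ∈ pairs γ, EdgeOpen d ω p.1 p.2 ∨ edgeMemPath d p.1 p.2 π := fun p hp =>
    or_iff_not_imp_right.2 fun h => hγπ p.1 p.2 (Or.inl hp) h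
  have hvisit : ∃ z ∈ γ, z ∈ boxZ d N e.val.1 := by
    refine ⟨e.val.1, he.elim (fun h => (mem_of_mem_pairs h).1) (fun h => (mem_of_mem_pairs h).2), ?_⟩
    exact normInf_le_iff.2 fun i => by simp
  obtain ⟨γ₁, hG₁, hcr₁, hr₁⟩ :=
    hπ.exists_crossing hn hN hC6 hCd hV2 hxinf hpath hwalk hedge hvisit
  obtain ⟨γ₂, hG₂, hcr₂, hr₂⟩ :=
    hπ.exists_crossing hn hN hC6 hCd hV2 hyinf (γ := γ.reverse)
      (isPath_iff.2 ⟨by simpa using hne, by simpa using hnd,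
        fun p hp => (hadj _ (mem_pairs_reverse.1 hp)).symm⟩) hwalk.reverse
      (fun p hp => (hedge _ (mem_pairs_reverse.1 hp)).imp EdgeOpen.symm edgeMemPath.symm)
      (by simpa using hvisit)
  obtain ⟨M, hMpath, hMo, hMann, ⟨u, hMu, hu⟩, ⟨v, hMv, hv⟩, hMlen⟩ :=
    hV1 γ₁ γ₂ hG₁ hcr₁ hG₂ hcr₂
  rw [isOpenPath_iff] at hMo
  have hMwalk : IsWalk u v M := ⟨hMu, hMv⟩
  have hMjoin : OpenJoined ω (boxZ d (3 * N) e.val.1) u v :=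
    ⟨M, hMwalk, hMo, fun z hz => (hMann z hz).1⟩
  have hMlen' : ((pairs M).length : ℝ) ≤ Cstar * N := by
    have : 1 ≤ M.length := List.length_pos_iff.2 hMpath.1
    rw [length_pairs, Nat.cast_sub this]
    simpa using hMlen
  suffices h : ∃ u' v' W₁ M' W₂, IsWalk x u' W₁ ∧ IsWalk u' v' M' ∧ IsWalk v' y W₂ ∧
      (∀ p ∈ pairs W₁, edgeMemPath d p.1 p.2 γ ∧
        ¬ (p.1 ∈ boxZ d N e.val.1 ∧ p.2 ∈ boxZ d N e.val.1)) ∧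
      (∀ p ∈ pairs W₂, edgeMemPath d p.1 p.2 γ ∧
        ¬ (p.1 ∈ boxZ d N e.val.1 ∧ p.2 ∈ boxZ d N e.val.1)) ∧
      (∀ p ∈ pairs M', EdgeOpen d ω p.1 p.2) ∧ (∀ z ∈ M', z ∈ boxZ d (4 * N) e.val.1) ∧
      ((pairs M').length : ℝ) ≤ Cstar * N by
    obtain ⟨u', v', W₁, M', W₂, h1, h2, h3, h4, h5, h6, h7, h8⟩ := h
    obtain ⟨η, k1, k2, k3, k4, k5, k6⟩ := hγ.splice h1 h2 h3 h4 h5 h6 h7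
    refine ⟨η, k1, k2, k3, k4, k5, ?_⟩
    have k7 : (diffEdgeCount d η γ : ℝ) ≤ (pairs M').length := by exact_mod_cast k6
    linarith
  have hrev : ∀ W, (∀ p ∈ pairs W, p ∈ pairs γ.reverse ∧ p.1 ∉ boxZ d N e.val.1) →
      ∀ p ∈ pairs W.reverse, edgeMemPath d p.1 p.2 γ ∧
        ¬ (p.1 ∈ boxZ d N e.val.1 ∧ p.2 ∈ boxZ d N e.val.1) := fun W hW p hp => by
    obtain ⟨h1, h2⟩ := hW _ (mem_pairs_reverse.1 hp)
    exact ⟨Or.inl (show p ∈ pairs γ by simpa using mem_pairs_reverse.1 h1), fun h => h2 h.2⟩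
  have hends : ∀ {a b}, OpenJoined ω (boxZ d (3 * N) e.val.1) a b →
      a ∈ boxZ d (3 * N) e.val.1 ∧ b ∈ boxZ d (3 * N) e.val.1 := by
    rintro a b ⟨W, hW, -, hWU⟩
    exact ⟨hWU _ hW.left_mem, hWU _ hW.right_mem⟩
  rcases hr₁ u hu with ⟨W₁, hW₁, hp₁⟩ | hj₁ <;> rcases hr₂ v hv with ⟨W₂, hW₂, hp₂⟩ | hj₂
  · refine ⟨u, v, W₁, M, W₂.reverse, hW₁, hMwalk, hW₂.reverse,
      fun p hp => ⟨Or.inl (hp₁ p hp).1, fun h => (hp₁ p hp).2 h.1⟩, hrev W₂ hp₂, hMo,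
      fun z hz => ?_, hMlen'⟩
    have := (hMann z hz).1
    change normInf d _ ≤ _
    omega
  · have hj := hMjoin.trans hj₂.symm
    obtain ⟨M', hM', hMo', hMbox', hMlen''⟩ := hV2.exists_walk (hends hj).1 (hends hj).2 hj
    exact ⟨u, y, W₁, M', [y], hW₁, hM', isWalk_singleton y,
      fun p hp => ⟨Or.inl (hp₁ p hp).1, fun h => (hp₁ p hp).2 h.1⟩, by simp, hMo', hMbox', hMlen''⟩
  · have hj := hj₁.trans hMjoin
    obtain ⟨M', hM', hMo', hMbox', hMlen''⟩ := hV2.exists_walk (hends hj).1 (hends hj).2 hj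
    exact ⟨x, v, [x], M', W₂.reverse, isWalk_singleton x, hM', hW₂.reverse, by simp,
      hrev W₂ hp₂, hMo', hMbox', hMlen''⟩
  · exact absurd ⟨(hends hj₁).1, (hends hj₂).1⟩ hxy

end Perco
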